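/- arXiv:1309.0233 — 2 statements merged into one kernel-verified Lean document; each statement's English description precedes it below -/
import Mathlib

section
/- For every λ > 0 there exist a function u : ℝ → ℝ and a function V : ℝ → ℝ with the following properties: u is positive, continuously differentiable on ℝ, twice differentiable on ℝ ∖ {−1, 1}, and u(x) = e^{−λ|x|} for |x| ≥ 1; V vanishes outside [−1, 1] and sup_{x∈ℝ} |V(x)| ≤ λ² + λ; and −u''(x) = (−λ² + V(x)) u(x) for every x ∈ ℝ ∖ {−1, 1}. Explicitly one may take u(x) = a − b x² for |x| ≤ 1 with b = λ e^{−λ}/2 and a = e^{−λ} + b, and V(x) = (λ² + 2b/(a − b x²)) for |x| < 1 and V(x) = 0 for |x| ≥ 1. -/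
open MeasureTheory

/-- Gluing two differentiable functions with matching 1-jets at `a`. -/
theorem glue_hasDerivAt (a : ℝ) (f g f' g' : ℝ → ℝ) (hf : ∀ x, HasDerivAt f (f' x) x)
    (hg : ∀ x, HasDerivAt g (g' x) x) (h0 : f a = g a) (h1 : f' a = g' a) (x : ℝ) :
    HasDerivAt (fun x => if x ≤ a then f x else g x) (if x ≤ a then f' x else g' x) x := by
  rcases lt_trichotomy x a with h | h | h
  · rw [if_pos h.le]
    refine (hf x).congr_of_eventuallyEq ?_
    filter_upwards [Iio_mem_nhds h] with y hy
    exact if_pos (le_of_lt hy)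
  · subst h
    rw [if_pos le_rfl, ← hasDerivWithinAt_univ, ← Set.Iic_union_Ici (a := x)]
    refine HasDerivWithinAt.union ?_ ?_
    · refine (hf x).hasDerivWithinAt.congr (fun y hy => if_pos hy) (if_pos le_rfl)
    · rw [h1]
      have key : ∀ y ∈ Set.Ici x, (if y ≤ x then f y else g y) = g y := by
        intro y hy
        split_ifs with hh
        · have : y = x := le_antisymm hh hy
          rw [this, h0]
        · rfl
      exact (hg x).hasDerivWithinAt.congr key (key x Set.self_mem_Ici)
  · rw [if_neg (not_le.mpr h)]
    refine (hg x).congr_of_eventuallyEq ?_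
    filter_upwards [Ioi_mem_nhds h] with y hy
    exact if_neg (not_le.mpr hy)

/-- The explicit construction behind Lemma 6.3 and Example 6.4 of the paper (dimension
`n = 2`, `k_m² = −λ² < 0`): for every `λ > 0` there is a positive `C¹` solution `u` of
`−u'' = (−λ² + V)u` off `{−1,1}`, equal to `e^{−λ|x|}` for `|x| ≥ 1`, with `V` supported
in `[−1,1]` and `|V| ≤ λ² + λ`; explicitly `u(x) = a − bx²` on `[−1,1]` with
`b = λe^{−λ}/2`, `a = e^{−λ} + b`, and `V(x) = λ² + 2b/(a − bx²)` on `(−1,1)`. -/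
theorem sharpness_example_dim2 (lam : ℝ) (hlam : 0 < lam) :
    ∃ u V : ℝ → ℝ,
      (∀ x, 0 < u x) ∧
      ContDiff ℝ 1 u ∧
      (∀ x : ℝ, x ≠ -1 → x ≠ 1 → DifferentiableAt ℝ (deriv u) x) ∧
      (∀ x : ℝ, 1 ≤ |x| → u x = Real.exp (-(lam * |x|))) ∧
      (∀ x : ℝ, x ∉ Set.Icc (-1 : ℝ) 1 → V x = 0) ∧
      (∀ x : ℝ, |V x| ≤ lam ^ 2 + lam) ∧
      (∀ x : ℝ, x ≠ -1 → x ≠ 1 → -(deriv (deriv u) x) = (-lam ^ 2 + V x) * u x) ∧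
      (∀ x : ℝ, |x| ≤ 1 →
        u x = (Real.exp (-lam) + lam * Real.exp (-lam) / 2)
          - (lam * Real.exp (-lam) / 2) * x ^ 2) ∧
      (∀ x : ℝ, |x| < 1 →
        V x = lam ^ 2 + (lam * Real.exp (-lam)) /
          ((Real.exp (-lam) + lam * Real.exp (-lam) / 2)
            - (lam * Real.exp (-lam) / 2) * x ^ 2)) := by
  set E := Real.exp (-lam) with hE
  have hEpos : 0 < E := Real.exp_pos _
  let f : ℝ → ℝ := fun x => Real.exp (lam * x)
  let f' : ℝ → ℝ := fun x => Real.exp (lam * x) * lam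
  let p : ℝ → ℝ := fun x => (E + lam * E / 2) - (lam * E / 2) * x ^ 2
  let p' : ℝ → ℝ := fun x => - (lam * E * x)
  let g : ℝ → ℝ := fun x => Real.exp (-lam * x)
  let g' : ℝ → ℝ := fun x => Real.exp (-lam * x) * (-lam)
  have hexp : ∀ c x : ℝ, HasDerivAt (fun x => Real.exp (c * x)) (Real.exp (c * x) * c) x := by
    intro c x
    simpa using ((hasDerivAt_id x).const_mul c).exp
  have hf : ∀ x, HasDerivAt f (f' x) x := hexp lam
  have hg : ∀ x, HasDerivAt g (g' x) x := hexp (-lam)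
  have hp : ∀ x, HasDerivAt p (p' x) x := by
    intro x
    have := ((hasDerivAt_pow 2 x).const_mul (lam * E / 2)).const_sub (E + lam * E / 2)
    refine HasDerivAt.congr_deriv this ?_
    simp only [p']
    push_cast
    ring
  have hp2 : ∀ x, HasDerivAt p' (-(lam * E)) x := by
    intro x
    have := ((hasDerivAt_id x).const_mul (lam * E)).neg
    refine HasDerivAt.congr_deriv this ?_
    ring
  let r : ℝ → ℝ := fun x => if x ≤ 1 then p x else g x
  let r' : ℝ → ℝ := fun x => if x ≤ 1 then p' x else g' x
  have hr : ∀ x, HasDerivAt r (r' x) x :=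
    glue_hasDerivAt 1 p g p' g' hp hg (by simp [p, g, hE]) (by simp [p', g', hE]; ring)
  have hm : (-1 : ℝ) ≤ 1 := by norm_num
  let u : ℝ → ℝ := fun x => if x ≤ -1 then f x else r x
  let d : ℝ → ℝ := fun x => if x ≤ -1 then f' x else r' x
  have hu : ∀ x, HasDerivAt u (d x) x :=
    glue_hasDerivAt (-1) f r f' r' hf hr (by simp [p, f, r, hE, hm])
      (by simp [p', f', r', hE, hm]; ring)
  have hd : deriv u = d := funext fun x => (hu x).deriv
  have hdc : Continuous d := by
    have hr'c : Continuous r' := by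
      refine Continuous.if_le (by fun_prop) (by fun_prop) continuous_id continuous_const ?_
      rintro x rfl
      simp [p', g', hE]; ring
    refine Continuous.if_le (by fun_prop) hr'c continuous_id continuous_const ?_
    intro x hx
    have hx : x = -1 := hx
    subst hx
    simp [p', f', r', hE, hm]; ring
  -- values of `u`
  have uin : ∀ x : ℝ, |x| ≤ 1 → u x = p x := by
    intro x hx
    obtain ⟨h1, h2⟩ := abs_le.mp hx
    by_cases h : x ≤ -1
    · have : x = -1 := le_antisymm h h1
      subst this
      simp [u, f, p, hE]
    · simp [u, r, h, h2]
  have uout : ∀ x : ℝ, 1 ≤ |x| → u x = Real.exp (-(lam * |x|)) := by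
    intro x hx
    rcases le_abs.mp hx with h | h
    · have hx0 : |x| = x := abs_of_nonneg (by linarith)
      have hn : ¬ x ≤ -1 := by linarith
      rw [hx0]
      by_cases h2 : x ≤ 1
      · have : x = 1 := le_antisymm h2 h
        subst this
        rw [uin 1 (by simp)]
        simp [p, hE]
      · simp [u, r, g, hn, h2]
    · have hx0 : |x| = -x := abs_of_nonpos (by linarith)
      have hn : x ≤ -1 := by linarith
      rw [hx0]
      simp [u, f, hn]
  have pge : ∀ x : ℝ, |x| ≤ 1 → E ≤ p x := by
    intro x hx
    have h2 : x ^ 2 ≤ 1 := by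
      rw [← sq_abs]; exact pow_le_one₀ (abs_nonneg x) hx
    have : 0 ≤ (lam * E / 2) * (1 - x ^ 2) := by
      apply mul_nonneg (by positivity); linarith
    simp only [p]
    linarith
  have din : ∀ x : ℝ, |x| < 1 → HasDerivAt d (-(lam * E)) x := by
    intro x hx
    obtain ⟨h1, h2⟩ := abs_lt.mp hx
    refine (hp2 x).congr_of_eventuallyEq ?_
    filter_upwards [Ioo_mem_nhds h1 h2] with y hy
    simp [d, r', not_le.mpr hy.1, hy.2.le]
  have dout : ∀ x : ℝ, 1 < |x| → HasDerivAt d (lam ^ 2 * u x) x := by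
    intro x hx
    rcases lt_abs.mp hx with h | h
    · have h1 : ¬ x ≤ -1 := by linarith
      have hux : u x = g x := by simp [u, r, h1, not_le.mpr h]
      have := (hg x).mul_const (-lam)
      rw [hux]
      have h3 : HasDerivAt g' (lam ^ 2 * g x) x := by
        refine HasDerivAt.congr_deriv this ?_
        simp only [g', g]; ring
      refine h3.congr_of_eventuallyEq ?_
      filter_upwards [Ioi_mem_nhds h] with y hy
      have hy : 1 < y := hy
      have h1 : ¬ y ≤ -1 := by linarith
      simp [d, r', h1, not_le.mpr hy]
    · have h1 : x < -1 := by linarith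
      have hux : u x = f x := by simp [u, h1.le]
      have := (hf x).mul_const lam
      rw [hux]
      have h3 : HasDerivAt f' (lam ^ 2 * f x) x := by
        refine HasDerivAt.congr_deriv this ?_
        simp only [f', f]; ring
      refine h3.congr_of_eventuallyEq ?_
      filter_upwards [Iio_mem_nhds h1] with y hy
      have hy : y < -1 := hy
      simp [d, hy.le]
  have hne : ∀ x : ℝ, x ≠ -1 → x ≠ 1 → |x| < 1 ∨ 1 < |x| := by
    intro x h1 h2
    refine lt_or_gt_of_ne fun h => ?_
    rcases (abs_eq zero_le_one).mp h with h | h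
    · exact h2 h
    · exact h1 h
  refine ⟨u, fun x => if |x| < 1 then lam ^ 2 + (lam * E) / p x else 0,
    ?_, ?_, ?_, uout, ?_, ?_, ?_, uin, ?_⟩
  · intro x
    rcases le_total (|x|) 1 with h | h
    · rw [uin x h]; exact hEpos.trans_le (pge x h)
    · rw [uout x h]; exact Real.exp_pos _
  · rw [contDiff_one_iff_deriv, hd]
    exact ⟨fun x => (hu x).differentiableAt, hdc⟩
  · intro x h1 h2
    rw [hd]
    rcases hne x h1 h2 with h | h
    · exact (din x h).differentiableAt
    · exact (dout x h).differentiableAt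
  · intro x hx
    refine if_neg fun h => hx ?_
    exact abs_le.mp h.le
  · intro x
    dsimp only
    split_ifs with h
    · have hpx := pge x h.le
      have hp0 : 0 < p x := hEpos.trans_le hpx
      rw [abs_of_nonneg (by positivity)]
      have : lam * E / p x ≤ lam := by
        rw [div_le_iff₀ hp0]
        exact mul_le_mul_of_nonneg_left hpx hlam.le
      linarith
    · rw [abs_zero]; positivity
  · intro x h1 h2
    rw [hd]
    dsimp only
    rcases hne x h1 h2 with h | h
    · have hp0 : 0 < p x := hEpos.trans_le (pge x h.le)
      rw [(din x h).deriv, if_pos h, uin x h.le]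
      field_simp
      ring
    · rw [(dout x h).deriv, if_neg (not_lt.mpr h.le)]
      ring
  · intro x hx
    exact if_pos hx
end

section
/- Let d ≥ 1, let k < π², set δ = √(π² − k), and let r₀ > 0. Define A = −δ e^{−δ r₀}/(2 r₀), B = (1 + δ r₀/2) e^{−δ r₀}, and s : [0,∞) → ℝ by s(r) = e^{−δ r} for r > r₀ and s(r) = A r² + B for r ≤ r₀. Define u : ℝ^d × ℝ → ℝ by u(x, y) = s(|x|) sin(π y), and V : ℝ^d × ℝ → ℝ by V(x, y) = δ(d−1)/|x| if |x| > r₀ and V(x, y) = δ² + 2δ d/(r₀² δ + 2 r₀ − δ |x|²) if |x| ≤ r₀. Then: (i) u is not identically zero and u(x, 0) = u(x, 1) = 0 for all x; (ii) for every (x, y) with |x| ≠ r₀, u is twice differentiable at (x, y) and −Δu(x, y) = (k + V(x, y)) u(x, y), where Δ is the Laplacian on ℝ^{d+1}; (iii) sup |V| = δ² + δ d / r₀. -/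
open MeasureTheory

/-- The Laplacian `Δu = Σ_{i=1}^d ∂²u/∂x_i² + ∂²u/∂y²` of a function on
`ℝ^d × ℝ = ℝ^{d+1}`. -/
noncomputable def slabLaplacian {d : ℕ} (u : EuclideanSpace ℝ (Fin d) × ℝ → ℝ)
    (p : EuclideanSpace ℝ (Fin d) × ℝ) : ℝ :=
  (∑ i : Fin d, iteratedFDeriv ℝ 2 u p
      ![(EuclideanSpace.single i 1, (0 : ℝ)), (EuclideanSpace.single i 1, (0 : ℝ))])
    + iteratedFDeriv ℝ 2 u p
        ![((0 : EuclideanSpace ℝ (Fin d)), (1 : ℝ)), ((0 : EuclideanSpace ℝ (Fin d)), (1 : ℝ))]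

open Filter Topology in
lemma second_dir {E : Type*} [NormedAddCommGroup E] [NormedSpace ℝ E] {u : E → ℝ} {p e : E}
    (hu : ContDiffAt ℝ 2 u p) {g' : ℝ → ℝ} {c : ℝ}
    (h1 : ∀ᶠ t in 𝓝 (0 : ℝ), HasDerivAt (fun t : ℝ => u (p + t • e)) (g' t) t)
    (h2 : HasDerivAt g' c 0) :
    iteratedFDeriv ℝ 2 u p ![e, e] = c := by
  rw [iteratedFDeriv_two_apply]
  simp only [Matrix.cons_val_zero, Matrix.cons_val_one]
  have hline : ∀ t : ℝ, HasDerivAt (fun t : ℝ => p + t • e) e t := fun t => by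
    simpa using ((hasDerivAt_id t).smul_const e).const_add p
  have hl0 : Tendsto (fun t : ℝ => p + t • e) (𝓝 0) (𝓝 p) := by
    have := (hline 0).continuousAt.tendsto
    simpa using this
  have hd : ∀ᶠ q in 𝓝 p, DifferentiableAt ℝ u q := by
    have := hu.eventually (by simp)
    filter_upwards [this] with q hq using hq.differentiableAt (by norm_num)
  have hfd : DifferentiableAt ℝ (fderiv ℝ u) p :=
    (hu.fderiv_right (m := 1) (by norm_num)).differentiableAt (by norm_num)
  have heq : g' =ᶠ[𝓝 0] fun t => fderiv ℝ u (p + t • e) e := by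
    filter_upwards [h1, hl0.eventually hd] with t ht hq
    exact ht.unique (hq.hasFDerivAt.comp_hasDerivAt t (hline t))
  have h3 : HasDerivAt (fun t : ℝ => fderiv ℝ u (p + t • e)) (fderiv ℝ (fderiv ℝ u) p e) 0 := by
    have hh : HasFDerivAt (fderiv ℝ u) (fderiv ℝ (fderiv ℝ u) p) (p + (0 : ℝ) • e) := by
      simpa using hfd.hasFDerivAt
    exact hh.comp_hasDerivAt 0 (hline 0)
  have h4 := h3.clm_apply (hasDerivAt_const (0 : ℝ) e)
  have h5 := h4.congr_of_eventuallyEq heq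
  have := h5.unique h2
  simpa using this

open Filter Topology in
lemma radial {d : ℕ} {u : EuclideanSpace ℝ (Fin d) × ℝ → ℝ} {x : EuclideanSpace ℝ (Fin d)} {y : ℝ}
    {F F' : ℝ → ℝ} {F'' : ℝ}
    (hu : u =ᶠ[𝓝 (x, y)] fun p => F (‖p.1‖ ^ 2) * Real.sin (Real.pi * p.2))
    (hF : ContDiffAt ℝ 2 F (‖x‖ ^ 2))
    (h1 : ∀ᶠ t in 𝓝 (‖x‖ ^ 2), HasDerivAt F (F' t) t)
    (h2 : HasDerivAt F' F'' (‖x‖ ^ 2)) :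
    (DifferentiableAt ℝ u (x, y) ∧ DifferentiableAt ℝ (fderiv ℝ u) (x, y)) ∧
    slabLaplacian u (x, y) = (4 * ‖x‖ ^ 2 * F'' + 2 * d * F' (‖x‖ ^ 2)
      - Real.pi ^ 2 * F (‖x‖ ^ 2)) * Real.sin (Real.pi * y) := by
  have hv : ContDiffAt ℝ 2 (fun p : EuclideanSpace ℝ (Fin d) × ℝ =>
      F (‖p.1‖ ^ 2) * Real.sin (Real.pi * p.2)) (x, y) := by
    apply ContDiffAt.mul
    · apply ContDiffAt.comp (x, y) (g := F) (f := fun p : EuclideanSpace ℝ (Fin d) × ℝ => ‖p.1‖ ^ 2)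
      · exact hF
      · exact (contDiff_fst.norm_sq ℝ).contDiffAt
    · exact (Real.contDiff_sin.comp (contDiff_const.mul contDiff_snd)).contDiffAt
  have huc : ContDiffAt ℝ 2 u (x, y) := hv.congr_of_eventuallyEq hu
  refine ⟨⟨huc.differentiableAt (by norm_num),
    (huc.fderiv_right (m := 1) (by norm_num)).differentiableAt (by norm_num)⟩, ?_⟩
  unfold slabLaplacian
  rw [(hu.iteratedFDeriv ℝ 2).eq_of_nhds]
  have hx : ∀ i : Fin d, iteratedFDeriv ℝ 2 (fun p : EuclideanSpace ℝ (Fin d) × ℝ =>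
      F (‖p.1‖ ^ 2) * Real.sin (Real.pi * p.2)) (x, y)
      ![(EuclideanSpace.single i 1, (0 : ℝ)), (EuclideanSpace.single i 1, (0 : ℝ))]
      = (4 * (x i) ^ 2 * F'' + 2 * F' (‖x‖ ^ 2)) * Real.sin (Real.pi * y) := by
    intro i
    set q : ℝ → ℝ := fun t => ‖x‖ ^ 2 + 2 * t * x i + t ^ 2 with hq
    have hqn : ∀ t : ℝ, ‖x + t • (EuclideanSpace.single i (1 : ℝ))‖ ^ 2 = q t := by
      intro t
      rw [norm_add_sq_real, inner_smul_right, norm_smul]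
      simp [hq, mul_pow, EuclideanSpace.inner_single_right]
      ring
    have hqd : ∀ t, HasDerivAt q (2 * x i + 2 * t) t := by
      intro t
      have a := ((((hasDerivAt_id t).const_mul 2).mul_const (x i)).const_add (‖x‖ ^ 2)).add
        ((hasDerivAt_id t).pow 2)
      refine HasDerivAt.congr_deriv a ?_
      simp
    have hq0 : q 0 = ‖x‖ ^ 2 := by simp [hq]
    have hqt : Tendsto q (𝓝 0) (𝓝 (‖x‖ ^ 2)) := by
      rw [← hq0]; exact (hqd 0).continuousAt.tendsto
    refine second_dir hv (g' := fun t => F' (q t) * (2 * x i + 2 * t) * Real.sin (Real.pi * y)) ?_ ?_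
    · filter_upwards [hqt.eventually h1] with t ht
      have := (ht.comp t (hqd t)).mul_const (Real.sin (Real.pi * y))
      refine this.congr_of_eventuallyEq (Eventually.of_forall fun t => ?_)
      simp [hqn]
    · rw [← hq0] at h2
      have a := ((h2.comp 0 (hqd 0)).mul
        (((hasDerivAt_id (0 : ℝ)).const_mul 2).const_add (2 * x i))).mul_const (Real.sin (Real.pi * y))
      refine HasDerivAt.congr_deriv a ?_
      simp [hq0]
      left
      ring
  have hy : iteratedFDeriv ℝ 2 (fun p : EuclideanSpace ℝ (Fin d) × ℝ =>
      F (‖p.1‖ ^ 2) * Real.sin (Real.pi * p.2)) (x, y)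
      ![((0 : EuclideanSpace ℝ (Fin d)), (1 : ℝ)), ((0 : EuclideanSpace ℝ (Fin d)), (1 : ℝ))]
      = - Real.pi ^ 2 * F (‖x‖ ^ 2) * Real.sin (Real.pi * y) := by
    have hl : ∀ t : ℝ, HasDerivAt (fun t : ℝ => Real.pi * (y + t)) Real.pi t := fun t => by
      simpa using ((hasDerivAt_id t).const_add y).const_mul Real.pi
    refine second_dir hv
      (g' := fun t => F (‖x‖ ^ 2) * (Real.cos (Real.pi * (y + t)) * Real.pi)) ?_ ?_
    · refine Eventually.of_forall fun t => ?_
      have := ((hl t).sin).const_mul (F (‖x‖ ^ 2))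
      simpa using this
    · have := (((hl 0).cos).mul_const Real.pi).const_mul (F (‖x‖ ^ 2))
      refine HasDerivAt.congr_deriv this ?_
      simp
      ring
  simp only [hx, hy]
  rw [← Finset.sum_mul, Finset.sum_add_distrib, ← Finset.sum_mul, ← Finset.mul_sum]
  have : ∑ i, x i ^ 2 = ‖x‖ ^ 2 := by
    rw [EuclideanSpace.norm_sq_eq]; simp
  rw [this]
  simp
  ring

/-- Example 6.9 of the paper: for `k < π²`, `δ = √(π² − k)` and any `r₀ > 0`, the
explicit functions `u(x,y) = s(|x|)sin(πy)` and `V` produce a nontrivial solution of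
`−Δu = (k + V)u` on the slab, vanishing on its boundary, with
`sup|V| = δ² + δd/r₀`. -/
theorem sharpness_example_small_k (d : ℕ) (hd : 1 ≤ d)
    (k : ℝ) (hk : k < Real.pi ^ 2) (r₀ : ℝ) (hr₀ : 0 < r₀)
    (δ A B : ℝ) (hδ : δ = Real.sqrt (Real.pi ^ 2 - k))
    (hA : A = -δ * Real.exp (-δ * r₀) / (2 * r₀))
    (hB : B = (1 + δ * r₀ / 2) * Real.exp (-δ * r₀))
    (s : ℝ → ℝ)
    (hs₁ : ∀ r : ℝ, r₀ < r → s r = Real.exp (-δ * r))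
    (hs₂ : ∀ r : ℝ, r ≤ r₀ → s r = A * r ^ 2 + B)
    (u V : EuclideanSpace ℝ (Fin d) × ℝ → ℝ)
    (hu : ∀ x y, u (x, y) = s ‖x‖ * Real.sin (Real.pi * y))
    (hV₁ : ∀ x y, r₀ < ‖x‖ → V (x, y) = δ * ((d : ℝ) - 1) / ‖x‖)
    (hV₂ : ∀ x y, ‖x‖ ≤ r₀ →
      V (x, y) = δ ^ 2 + 2 * δ * (d : ℝ) / (r₀ ^ 2 * δ + 2 * r₀ - δ * ‖x‖ ^ 2)) :
    (u ≠ 0 ∧ ∀ x, u (x, 0) = 0 ∧ u (x, 1) = 0) ∧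
    (∀ (x : EuclideanSpace ℝ (Fin d)) (y : ℝ), ‖x‖ ≠ r₀ →
      (DifferentiableAt ℝ u (x, y) ∧ DifferentiableAt ℝ (fderiv ℝ u) (x, y)) ∧
      -(slabLaplacian u (x, y)) = (k + V (x, y)) * u (x, y)) ∧
    (⨆ p : EuclideanSpace ℝ (Fin d) × ℝ, |V p|) = δ ^ 2 + δ * (d : ℝ) / r₀ := by
  have hδ0 : 0 < δ := by rw [hδ]; exact Real.sqrt_pos.mpr (by linarith)
  have hδ2 : δ ^ 2 = Real.pi ^ 2 - k := by rw [hδ]; exact Real.sq_sqrt (by linarith)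
  have hd1 : (1 : ℝ) ≤ d := by exact_mod_cast hd
  have hE : 0 < Real.exp (-δ * r₀) := Real.exp_pos _
  refine ⟨⟨?_, ?_⟩, ?_, ?_⟩
  · intro h
    have h0 := congrFun h (0, 1 / 2)
    rw [hu, hs₂ _ (by simpa using hr₀.le)] at h0
    have : Real.sin (Real.pi * (1 / 2)) = 1 := by rw [mul_one_div, Real.sin_pi_div_two]
    rw [this] at h0
    simp at h0
    rw [hB] at h0
    have : 0 < (1 + δ * r₀ / 2) * Real.exp (-δ * r₀) := by positivity
    linarith
  · intro x
    simp [hu]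
  · intro x y hx
    rcases lt_or_gt_of_ne hx with hlt | hgt
    · have hev : u =ᶠ[nhds (x, y)] fun p => (fun t => A * t + B) (‖p.1‖ ^ 2) * Real.sin (Real.pi * p.2) := by
        have : ∀ᶠ p : EuclideanSpace ℝ (Fin d) × ℝ in nhds (x, y), ‖p.1‖ < r₀ :=
          (continuous_fst.norm.continuousAt).eventually_lt continuousAt_const hlt
        filter_upwards [this] with p hp
        rw [← Prod.mk.eta (p := p), hu, hs₂ _ hp.le]
      have key := radial (F := fun t => A * t + B) (F' := fun _ => A) (F'' := 0) hev (by fun_prop)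
        (Filter.Eventually.of_forall fun t => by
          simpa using ((hasDerivAt_id t).const_mul A).add_const B)
        (hasDerivAt_const _ _)
      refine ⟨key.1, ?_⟩
      rw [key.2, hu, hs₂ _ hlt.le, hV₂ _ _ hlt.le]
      have hD : 0 < r₀ ^ 2 * δ + 2 * r₀ - δ * ‖x‖ ^ 2 := by
        have : ‖x‖ ^ 2 ≤ r₀ ^ 2 := by gcongr
        nlinarith
      have hAB : A * ‖x‖ ^ 2 + B = Real.exp (-δ * r₀) / (2 * r₀) *
          (r₀ ^ 2 * δ + 2 * r₀ - δ * ‖x‖ ^ 2) := by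
        rw [hA, hB]; field_simp; ring
      have hk' : k = Real.pi ^ 2 - δ ^ 2 := by linarith
      simp only [hAB]
      rw [hA, hk']
      generalize r₀ ^ 2 * δ + 2 * r₀ - δ * ‖x‖ ^ 2 = D at hD ⊢
      field_simp
      ring
    · have hx0 : 0 < ‖x‖ := hr₀.trans hgt
      have hx2 : 0 < ‖x‖ ^ 2 := by positivity
      have hev : u =ᶠ[nhds (x, y)] fun p => (fun t => Real.exp (-δ * Real.sqrt t)) (‖p.1‖ ^ 2)
          * Real.sin (Real.pi * p.2) := by
        have : ∀ᶠ p : EuclideanSpace ℝ (Fin d) × ℝ in nhds (x, y), r₀ < ‖p.1‖ :=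
          continuousAt_const.eventually_lt (continuous_fst.norm.continuousAt) hgt
        filter_upwards [this] with p hp
        rw [← Prod.mk.eta (p := p), hu, hs₁ _ hp]
        simp
      have hder : ∀ t : ℝ, 0 < t → HasDerivAt (fun t => Real.exp (-δ * Real.sqrt t))
          (Real.exp (-δ * Real.sqrt t) * (-δ * (1 / (2 * Real.sqrt t)))) t := fun t ht =>
        ((Real.hasDerivAt_sqrt ht.ne').const_mul (-δ)).exp
      have hsq := Real.hasDerivAt_sqrt hx2.ne'
      have hne : 2 * Real.sqrt (‖x‖ ^ 2) ≠ 0 := by positivity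
      have h2 := (hder _ hx2).mul
        (((hasDerivAt_const _ (1 : ℝ)).div (hsq.const_mul 2) hne).const_mul (-δ))
      have key := radial (F := fun t => Real.exp (-δ * Real.sqrt t)) hev
        (Real.contDiff_exp.contDiffAt.comp _
          (contDiffAt_const.mul (Real.contDiffAt_sqrt hx2.ne')))
        (by filter_upwards [lt_mem_nhds hx2] with t ht using hder t ht)
        h2
      refine ⟨key.1, ?_⟩
      rw [key.2, hu, hs₁ _ hgt, hV₁ _ _ hgt]
      have hk' : k = Real.pi ^ 2 - δ ^ 2 := by linarith
      simp only [Real.sqrt_sq hx0.le, Pi.mul_apply, Pi.div_apply]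
      rw [hk']
      field_simp
      ring
  · have hub : ∀ p, |V p| ≤ δ ^ 2 + δ * d / r₀ := by
      rintro ⟨x, y⟩
      rcases le_or_gt ‖x‖ r₀ with h | h
      · rw [hV₂ _ _ h]
        have hle : 2 * r₀ ≤ r₀ ^ 2 * δ + 2 * r₀ - δ * ‖x‖ ^ 2 := by
          have : ‖x‖ ^ 2 ≤ r₀ ^ 2 := by gcongr
          nlinarith
        have hD : 0 < r₀ ^ 2 * δ + 2 * r₀ - δ * ‖x‖ ^ 2 := by linarith
        rw [abs_of_nonneg (by positivity)]
        have : 2 * δ * d / (r₀ ^ 2 * δ + 2 * r₀ - δ * ‖x‖ ^ 2) ≤ 2 * δ * d / (2 * r₀) := by gcongr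
        have e : 2 * δ * d / (2 * r₀) = δ * d / r₀ := by field_simp
        linarith
      · rw [hV₁ _ _ h]
        have hx0 : 0 < ‖x‖ := hr₀.trans h
        have : 0 ≤ δ * ((d : ℝ) - 1) := mul_nonneg hδ0.le (by linarith)
        rw [abs_of_nonneg (by positivity)]
        have : δ * ((d : ℝ) - 1) / ‖x‖ ≤ δ * d / r₀ := by
          gcongr
          linarith
        nlinarith [sq_nonneg δ]
    apply le_antisymm (ciSup_le hub)
    let x₀ : EuclideanSpace ℝ (Fin d) := EuclideanSpace.single ⟨0, hd⟩ r₀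
    have hx₀ : ‖x₀‖ = r₀ := by simp [x₀, abs_of_pos hr₀]
    have hval : |V (x₀, 0)| = δ ^ 2 + δ * d / r₀ := by
      rw [hV₂ _ _ hx₀.le, hx₀]
      have e : 2 * δ * d / (r₀ ^ 2 * δ + 2 * r₀ - δ * r₀ ^ 2) = δ * d / r₀ := by
        rw [show r₀ ^ 2 * δ + 2 * r₀ - δ * r₀ ^ 2 = 2 * r₀ by ring]
        field_simp
      rw [e, abs_of_nonneg (by positivity)]
    rw [← hval]
    exact le_ciSup (f := fun p => |V p|) ⟨_, by rintro _ ⟨p, rfl⟩; exact hub p⟩ (x₀, 0)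
end
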